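/- Under the linear model Y = Xᵀβ + ε with ε independent of X, E(ε) = 0, E(ε²) = σ², E‖X‖⁴ < ∞, for any fixed vectors a, b ∈ ℝ^p the difference of squared losses ξ = (Y − Xᵀa)² − (Y − Xᵀb)² satisfies Var(ξ) = 4σ² (a − b)ᵀ Σ (a − b) + E[ ( (a + b − 2β)ᵀ (XXᵀ − Σ) (a − b) )² ], where Σ = E(XXᵀ). (Variance identity (eq:ols_xi_var_upper) in the proof of Theorem 2 of the paper.) -/

import Mathlib

open MeasureTheory ProbabilityTheory
open scoped ENNReal NNReal

/-- Variance of `ε U + W` for a centred `ε` independent of `(U, W)`. -/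
lemma variance_mul_add_of_indepFun {Ω : Type*} [MeasurableSpace Ω] {μ : Measure Ω}
    [IsProbabilityMeasure μ] {ε U W : Ω → ℝ} (hε : MemLp ε 2 μ) (hU : MemLp U 2 μ)
    (hW : MemLp W 2 μ) (hindep : IndepFun ε (fun ω => (U ω, W ω)) μ)
    (hmean : ∫ ω, ε ω ∂μ = 0) :
    variance (fun ω => ε ω * U ω + W ω) μ =
      (∫ ω, ε ω ^ 2 ∂μ) * (∫ ω, U ω ^ 2 ∂μ) + variance W μ := by
  have hεU : IndepFun ε U μ := hindep.comp measurable_id measurable_fst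
  have hsq : IndepFun (fun ω => ε ω ^ 2) (fun ω => U ω ^ 2) μ :=
    hεU.comp (measurable_id.pow_const 2) (measurable_id.pow_const 2)
  have hcross : IndepFun ε (fun ω => U ω * W ω) μ :=
    hindep.comp measurable_id (measurable_fst.mul measurable_snd)
  have hmem : MemLp (fun ω => ε ω * U ω) 2 μ := by
    refine (memLp_two_iff_integrable_sq
      (hε.aestronglyMeasurable.mul hU.aestronglyMeasurable)).2 ?_
    simpa only [Pi.mul_def, mul_pow] using hsq.integrable_mul hε.integrable_sq hU.integrable_sq
  have hzero : ∫ ω, ε ω * U ω ∂μ = 0 := by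
    rw [hεU.integral_fun_mul_eq_mul_integral hε.aestronglyMeasurable hU.aestronglyMeasurable,
      hmean, zero_mul]
  have hcov : covariance (fun ω => ε ω * U ω) W μ = 0 := by
    rw [covariance_eq_sub hmem hW, hzero, zero_mul, sub_zero]
    simp only [Pi.mul_apply, mul_assoc]
    rw [hcross.integral_fun_mul_eq_mul_integral hε.aestronglyMeasurable
      (hU.aestronglyMeasurable.mul hW.aestronglyMeasurable), hmean, zero_mul]
  have hvar : variance (fun ω => ε ω * U ω) μ = (∫ ω, ε ω ^ 2 ∂μ) * (∫ ω, U ω ^ 2 ∂μ) := by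
    rw [variance_of_integral_eq_zero hmem.aemeasurable hzero]
    simp only [mul_pow]
    exact hsq.integral_fun_mul_eq_mul_integral hε.integrable_sq.aestronglyMeasurable
      hU.integrable_sq.aestronglyMeasurable
  have h := variance_add hmem hW
  rw [hcov, mul_zero, add_zero, hvar] at h
  exact h

lemma sum_mul_mul_eq_mul_sum {ι : Type*} [Fintype ι] (c d x : ι → ℝ) :
    ∑ j, ∑ k, c j * (x j * x k) * d k = (∑ j, x j * c j) * ∑ k, x k * d k := by
  rw [Finset.sum_mul_sum]
  exact Finset.sum_congr rfl fun j _ => Finset.sum_congr rfl fun k _ => by ring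

lemma integral_linear_mul_linear {Ω ι : Type*} [MeasurableSpace Ω] [Fintype ι] {μ : Measure Ω}
    {X : Ω → ι → ℝ} (hX : ∀ j k, Integrable (fun ω => X ω j * X ω k) μ) (c d : ι → ℝ) :
    ∫ ω, (∑ j, X ω j * c j) * (∑ k, X ω k * d k) ∂μ =
      ∑ j, ∑ k, c j * (∫ ω, X ω j * X ω k ∂μ) * d k := by
  simp only [← sum_mul_mul_eq_mul_sum]
  rw [integral_finsetSum _ fun j _ =>
    integrable_finsetSum _ fun k _ => ((hX j k).const_mul _).mul_const _]
  refine Finset.sum_congr rfl fun j _ => ?_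
  rw [integral_finsetSum _ fun k _ => ((hX j k).const_mul _).mul_const _]
  refine Finset.sum_congr rfl fun k _ => ?_
  rw [integral_mul_const, integral_const_mul]

/-- Variance identity (eq:ols_xi_var_upper) in the proof of Theorem 2 of the paper:
under the linear model `Y = Xᵀβ + ε` with `ε` independent of `X`, `E ε = 0`,
`E ε² = σ²`, `E‖X‖⁴ < ∞`, for fixed `a, b ∈ ℝ^p` the difference of squared losses
`ξ = (Y − Xᵀa)² − (Y − Xᵀb)²` satisfies
`Var(ξ) = 4σ² (a−b)ᵀ Σ (a−b) + E[((a+b−2β)ᵀ (XXᵀ − Σ)(a−b))²]`, where `Σ = E(XXᵀ)`. -/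
theorem linear_model_loss_diff_variance_identity
    {Ω : Type*} [MeasurableSpace Ω] (μ : Measure Ω) [IsProbabilityMeasure μ]
    {p : ℕ} (X : Ω → Fin p → ℝ) (ε : Ω → ℝ) (Y : Ω → ℝ) (β a b : Fin p → ℝ) (σ : ℝ)
    (hX : Measurable X) (hε : Measurable ε)
    (hindep : IndepFun ε X μ)
    (hmodel : ∀ ω, Y ω = (∑ j, X ω j * β j) + ε ω)
    (hmean : ∫ ω, ε ω ∂μ = 0)
    (hε2 : Integrable (fun ω => ε ω ^ 2) μ)
    (hσ : ∫ ω, ε ω ^ 2 ∂μ = σ ^ 2)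
    (hX4 : Integrable (fun ω => (∑ j, X ω j ^ 2) ^ 2) μ) :
    variance
        (fun ω => (Y ω - ∑ j, X ω j * a j) ^ 2 - (Y ω - ∑ j, X ω j * b j) ^ 2) μ =
      4 * σ ^ 2 *
          (∑ j, ∑ k, (a j - b j) * (∫ ω, X ω j * X ω k ∂μ) * (a k - b k)) +
        ∫ ω, (∑ j, ∑ k,
            (a j + b j - 2 * β j) * (X ω j * X ω k - ∫ ω', X ω' j * X ω' k ∂μ) *
              (a k - b k)) ^ 2 ∂μ := by
  have hXj (j : Fin p) : Measurable fun ω => X ω j := (measurable_pi_apply j).comp hX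
  have hlin (c : Fin p → ℝ) : Measurable fun ω => ∑ j, X ω j * c j :=
    Finset.measurable_sum _ fun j _ => (hXj j).mul_const _
  have hcs (c : Fin p → ℝ) (ω : Ω) :
      (∑ j, X ω j * c j) ^ 2 ≤ (∑ j, X ω j ^ 2) * ∑ j, c j ^ 2 :=
    Finset.sum_mul_sq_le_sq_mul_sq _ _ _
  have hN : Integrable (fun ω => ∑ j, X ω j ^ 2) μ :=
    ((memLp_two_iff_integrable_sq (Finset.measurable_sum _ fun j _ =>
      (hXj j).pow_const 2).aestronglyMeasurable).2 hX4).integrable one_le_two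
  have hlin_mem (c : Fin p → ℝ) : MemLp (fun ω => ∑ j, X ω j * c j) 2 μ := by
    refine (memLp_two_iff_integrable_sq (hlin c).aestronglyMeasurable).2 ?_
    refine (hN.mul_const (∑ j, c j ^ 2)).mono' ((hlin c).pow_const 2).aestronglyMeasurable
      (ae_of_all _ fun ω => ?_)
    rw [Real.norm_of_nonneg (sq_nonneg _)]
    exact hcs c ω
  have hprod_mem (c d : Fin p → ℝ) :
      MemLp (fun ω => (∑ j, X ω j * c j) * ∑ j, X ω j * d j) 2 μ := by
    have hm := (hlin c).mul (hlin d)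
    refine (memLp_two_iff_integrable_sq hm.aestronglyMeasurable).2 ?_
    refine (hX4.mul_const ((∑ j, c j ^ 2) * ∑ j, d j ^ 2)).mono'
      (hm.pow_const 2).aestronglyMeasurable (ae_of_all _ fun ω => ?_)
    rw [Real.norm_of_nonneg (sq_nonneg _)]
    calc ((∑ j, X ω j * c j) * ∑ j, X ω j * d j) ^ 2
        = (∑ j, X ω j * c j) ^ 2 * (∑ j, X ω j * d j) ^ 2 := mul_pow _ _ _
      _ ≤ ((∑ j, X ω j ^ 2) * ∑ j, c j ^ 2) * ((∑ j, X ω j ^ 2) * ∑ j, d j ^ 2) :=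
          mul_le_mul (hcs c ω) (hcs d ω) (sq_nonneg _) (by positivity)
      _ = _ := by ring
  have hXX (j k : Fin p) : Integrable (fun ω => X ω j * X ω k) μ := by
    have hmem (i : Fin p) : MemLp (fun ω => X ω i) 2 μ := by
      simpa [Pi.single_apply] using hlin_mem (Pi.single i 1)
    exact (hmem j).integrable_mul (hmem k)
  set c : Fin p → ℝ := fun j => a j + b j - 2 * β j with hc
  set d : Fin p → ℝ := fun j => a j - b j with hd
  have hξ : (fun ω => (Y ω - ∑ j, X ω j * a j) ^ 2 - (Y ω - ∑ j, X ω j * b j) ^ 2) =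
      fun ω => ε ω * (-2 * ∑ j, X ω j * d j) + (∑ j, X ω j * c j) * ∑ j, X ω j * d j := by
    funext ω
    have hdω : ∑ j, X ω j * d j = ∑ j, X ω j * a j - ∑ j, X ω j * b j := by
      simp only [hd, mul_sub, Finset.sum_sub_distrib]
    have hcω : ∑ j, X ω j * c j =
        ∑ j, X ω j * a j + ∑ j, X ω j * b j - 2 * ∑ j, X ω j * β j := by
      simp only [hc, mul_sub, mul_add, Finset.sum_sub_distrib, Finset.sum_add_distrib,
        Finset.mul_sum, mul_left_comm]
    rw [hdω, hcω, hmodel ω]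
    ring
  have hind : IndepFun ε (fun ω => (-2 * ∑ j, X ω j * d j,
      (∑ j, X ω j * c j) * ∑ j, X ω j * d j)) μ :=
    hindep.comp (φ := id) (ψ := fun x : Fin p → ℝ => (-2 * ∑ j, x j * d j,
      (∑ j, x j * c j) * ∑ j, x j * d j)) measurable_id (by fun_prop)
  have hεmem : MemLp ε 2 μ := (memLp_two_iff_integrable_sq hε.aestronglyMeasurable).2 hε2
  rw [hξ, variance_mul_add_of_indepFun hεmem ((hlin_mem d).const_mul (-2)) (hprod_mem c d) hind
    hmean, hσ, variance_eq_integral (hprod_mem c d).aemeasurable,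
    integral_linear_mul_linear hXX c d]
  congr 1
  · rw [← integral_linear_mul_linear hXX d d]
    simp only [mul_pow, ← pow_two]
    rw [integral_const_mul]
    ring
  · refine integral_congr_ae (ae_of_all _ fun ω => ?_)
    simp only [← sum_mul_mul_eq_mul_sum, ← Finset.sum_sub_distrib, ← sub_mul, ← mul_sub, hc, hd]
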